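/- arXiv:2402.08209 — 2 statements merged into one kernel-verified Lean document; each statement's English description precedes it below -/
import Mathlib

section
/- Let m be a positive integer, let y_min ≤ y_max be real numbers, let y : Fin m → ℝ satisfy y_min ≤ y i ≤ y_max for all i, and let a, b be real numbers with y_min ≤ a ≤ y_max and y_min ≤ b ≤ y_max. Then |(1/m)·∑_{i}(y i − a)² − (1/m)·∑_{i}(y i − b)²| ≤ 2·|a − b|·(y_max − y_min). -/
theorem abs_sq_sub_sub_sq_sub_le {l u x a b : ℝ} (hx : l ≤ x ∧ x ≤ u)
    (ha : l ≤ a ∧ a ≤ u) (hb : l ≤ b ∧ b ≤ u) :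
    |(x - a) ^ 2 - (x - b) ^ 2| ≤ 2 * |a - b| * (u - l) := by
  have h : |a + b - 2 * x| ≤ 2 * (u - l) := by
    rw [abs_le]
    constructor <;> linarith [hx.1, hx.2, ha.1, ha.2, hb.1, hb.2]
  calc |(x - a) ^ 2 - (x - b) ^ 2| = |a - b| * |a + b - 2 * x| := by
        rw [← abs_mul]
        ring_nf
    _ ≤ |a - b| * (2 * (u - l)) := by gcongr
    _ = 2 * |a - b| * (u - l) := by ring

theorem mse_diff_const_pred_bound
    (m : ℕ) (hm : 0 < m) (ymin ymax : ℝ) (hyy : ymin ≤ ymax)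
    (y : Fin m → ℝ) (hy : ∀ i, ymin ≤ y i ∧ y i ≤ ymax)
    (a b : ℝ) (ha : ymin ≤ a ∧ a ≤ ymax) (hb : ymin ≤ b ∧ b ≤ ymax) :
    |(1 / m : ℝ) * ∑ i, (y i - a) ^ 2 - (1 / m : ℝ) * ∑ i, (y i - b) ^ 2| ≤
      2 * |a - b| * (ymax - ymin) := by
  have hm' : (0 : ℝ) < m := Nat.cast_pos.mpr hm
  rw [← mul_sub, ← Finset.sum_sub_distrib, abs_mul, abs_of_pos (one_div_pos.mpr hm'),
    one_div, inv_mul_le_iff₀ hm']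
  calc |∑ i, ((y i - a) ^ 2 - (y i - b) ^ 2)|
      ≤ ∑ i, |(y i - a) ^ 2 - (y i - b) ^ 2| := Finset.abs_sum_le_sum_abs _ _
    _ ≤ ∑ _i : Fin m, 2 * |a - b| * (ymax - ymin) :=
        Finset.sum_le_sum fun i _ => abs_sq_sub_sub_sq_sub_le (hy i) ha hb
    _ = m * (2 * |a - b| * (ymax - ymin)) := by simp
end

section
/- Let m and k be positive integers, let n_inst be a positive integer with k ≥ n_inst, and let y_min ≤ y_max be real numbers. Let v : Fin m → ℝ satisfy y_min ≤ v i ≤ y_max for all i, let y : Fin k → ℝ satisfy y_min ≤ y i ≤ y_max for all i, and let c be a real number with y_min ≤ c ≤ y_max. Set a = (1/k)·∑_{i} y i and b = (c + ∑_{i} y i)/(k + 1). Then |(1/m)·∑_{i}(v i − a)² − (1/m)·∑_{i}(v i − b)²| ≤ 2·(y_max − y_min)²/(n_inst + 1). -/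
/-- The mean of finitely many reals in an interval lies in that interval. -/
theorem mean_mem_Icc {n : ℕ} (hn : 0 < n) {l u : ℝ} {f : Fin n → ℝ}
    (hf : ∀ i, f i ∈ Set.Icc l u) : (1 / n : ℝ) * ∑ i, f i ∈ Set.Icc l u := by
  have hn' : (0 : ℝ) < n := by exact_mod_cast hn
  have hl := Finset.card_nsmul_le_sum Finset.univ f l fun i _ => (hf i).1
  have hu := Finset.sum_le_card_nsmul Finset.univ f u fun i _ => (hf i).2
  simp only [Finset.card_univ, Fintype.card_fin, nsmul_eq_mul] at hl hu
  rw [one_div_mul_eq_div]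
  exact ⟨(le_div_iff₀' hn').2 hl, (div_le_iff₀' hn').2 hu⟩

/-- Moving a prediction `a` towards `c` by a fraction `t` changes the squared error at `v` by at
most `2 * t` times the square of the length of an interval containing all three. -/
theorem sq_error_sub_mem_Icc {l u v a c t : ℝ} (hv : v ∈ Set.Icc l u) (ha : a ∈ Set.Icc l u)
    (hc : c ∈ Set.Icc l u) (ht₀ : 0 ≤ t) (ht₁ : t ≤ 1) :
    (v - a) ^ 2 - (v - (a + t * (c - a))) ^ 2 ∈
      Set.Icc (-(2 * (u - l) ^ 2 * t)) (2 * (u - l) ^ 2 * t) := by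
  obtain ⟨hb₁, hb₂⟩ : a + t * (c - a) ∈ Set.Icc l u := by
    simpa using (convex_Icc l u).add_smul_sub_mem ha hc ⟨ht₀, ht₁⟩
  obtain ⟨hv₁, hv₂⟩ := hv
  obtain ⟨ha₁, ha₂⟩ := ha
  obtain ⟨hc₁, hc₂⟩ := hc
  have hca : |c - a| ≤ u - l := abs_le.2 ⟨by linarith, by linarith⟩
  have hvab : |2 * v - a - (a + t * (c - a))| ≤ 2 * (u - l) :=
    abs_le.2 ⟨by linarith, by linarith⟩
  rw [Set.mem_Icc, ← abs_le]
  calc |(v - a) ^ 2 - (v - (a + t * (c - a))) ^ 2|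
      = t * (|c - a| * |2 * v - a - (a + t * (c - a))|) := by
        rw [show (v - a) ^ 2 - (v - (a + t * (c - a))) ^ 2 =
          t * ((c - a) * (2 * v - a - (a + t * (c - a)))) by ring,
          abs_mul, abs_mul, abs_of_nonneg ht₀]
    _ ≤ t * ((u - l) * (2 * (u - l))) := by
        gcongr
        linarith
    _ = 2 * (u - l) ^ 2 * t := by ring

theorem tree_width_core_inequality
    (m k n_inst : ℕ) (hm : 0 < m) (hk : 0 < k) (hni : 0 < n_inst)
    (hkn : n_inst ≤ k) (ymin ymax : ℝ) (hyy : ymin ≤ ymax)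
    (v : Fin m → ℝ) (hv : ∀ i, ymin ≤ v i ∧ v i ≤ ymax)
    (y : Fin k → ℝ) (hy : ∀ i, ymin ≤ y i ∧ y i ≤ ymax)
    (c : ℝ) (hc : ymin ≤ c ∧ c ≤ ymax) :
    |(1 / m : ℝ) * ∑ i, (v i - (1 / k : ℝ) * ∑ j, y j) ^ 2 -
        (1 / m : ℝ) * ∑ i, (v i - (c + ∑ j, y j) / (k + 1)) ^ 2| ≤
      2 * (ymax - ymin) ^ 2 / (n_inst + 1) := by
  have hk' : (0 : ℝ) < k := by exact_mod_cast hk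
  have hb : (c + ∑ j, y j) / (k + 1 : ℝ) =
      (1 / k : ℝ) * ∑ j, y j + 1 / (k + 1) * (c - (1 / k : ℝ) * ∑ j, y j) := by
    field_simp
    ring
  rw [hb, ← mul_sub, ← Finset.sum_sub_distrib]
  have ht₁ : (1 : ℝ) / (k + 1) ≤ 1 := (div_le_one (by positivity)).2 (by linarith)
  refine (abs_le.2 (mean_mem_Icc hm fun i =>
    sq_error_sub_mem_Icc (hv i) (mean_mem_Icc hk hy) hc (by positivity) ht₁)).trans ?_
  rw [mul_one_div]
  gcongr
end
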